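/- Let m ≥ 1, n_t = 2^m, and let N ≥ 1. Let L₁ be the n_t·N × n_t·N block matrix, with n_t×n_t blocks each of size N×N, whose diagonal blocks are I_N, whose blocks immediately below the diagonal are −I_N, and whose other blocks are zero. Then L₁ = [ I2^{⊗m} − I2^{⊗(m−1)} ⊗ τ2 − Σ_{j=2}^{m} I2^{⊗(j−2)} ⊗ τ2 ⊗ τ1^{⊗(m−j+1)} ] ⊗ I_N. -/

import Mathlib

noncomputable section
open Matrix BigOperators Finset

/-- Kronecker product of complex matrices, with the big-endian index identification
`i = p·i₁ + i₂` (first factor is the high-order register). -/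
def kron {m n p q : ℕ} (A : Matrix (Fin m) (Fin n) ℂ) (B : Matrix (Fin p) (Fin q) ℂ) :
    Matrix (Fin (m * p)) (Fin (n * q)) ℂ :=
  Matrix.of fun i j => A i.divNat j.divNat * B i.modNat j.modNat

/-- `l`-fold Kronecker power `B^{⊗l}`. -/
def kronPow {n : ℕ} (B : Matrix (Fin n) (Fin n) ℂ) : (l : ℕ) → Matrix (Fin (n ^ l)) (Fin (n ^ l)) ℂ
  | 0 => 1
  | l + 1 => kron (kronPow B l) B

/-- Recast a matrix along equalities of its dimensions. -/
def mcast {a b c d : ℕ} (h1 : a = b) (h2 : c = d) (M : Matrix (Fin a) (Fin c) ℂ) :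
    Matrix (Fin b) (Fin d) ℂ :=
  M.submatrix (Fin.cast h1.symm) (Fin.cast h2.symm)

/-- τ0, τ1, τ2, τ3. -/
def τ : Fin 4 → Matrix (Fin 2) (Fin 2) ℂ
  | 0 => !![1, 0; 0, 0]
  | 1 => !![0, 1; 0, 0]
  | 2 => !![0, 0; 1, 0]
  | 3 => !![0, 0; 0, 1]

/-- The n_t·N × n_t·N block lower-bidiagonal matrix (n_t = 2^m blocks of size N×N)
with I_N on the block diagonal, −I_N immediately below the diagonal, 0 elsewhere.
Index i belongs to block row i / N and to row i % N within the block. -/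
def L1mat (m N : ℕ) : Matrix (Fin (2 ^ m * N)) (Fin (2 ^ m * N)) ℂ :=
  Matrix.of fun i j =>
    if (i : ℕ) % N = (j : ℕ) % N then
      if (i : ℕ) / N = (j : ℕ) / N then 1
      else if (i : ℕ) / N = (j : ℕ) / N + 1 then -1
      else 0
    else 0

theorem kron_apply {m n p q : ℕ} (A : Matrix (Fin m) (Fin n) ℂ) (B : Matrix (Fin p) (Fin q) ℂ)
    (i : Fin (m * p)) (j : Fin (n * q)) :
    kron A B i j = A i.divNat j.divNat * B i.modNat j.modNat := rfl

theorem mcast_apply {a b c d : ℕ} (h1 : a = b) (h2 : c = d) (M : Matrix (Fin a) (Fin c) ℂ)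
    (i : Fin b) (j : Fin d) :
    mcast h1 h2 M i j = M (Fin.cast h1.symm i) (Fin.cast h2.symm j) := rfl

theorem kron_one_one {m n : ℕ} :
    kron (1 : Matrix (Fin m) (Fin m) ℂ) (1 : Matrix (Fin n) (Fin n) ℂ) = 1 := by
  ext i j
  have key : i = j ↔ i.divNat = j.divNat ∧ i.modNat = j.modNat := by
    simp only [Fin.ext_iff, Fin.coe_divNat, Fin.coe_modNat]
    refine ⟨fun h => by simp [h], fun ⟨h₁, h₂⟩ => ?_⟩
    rw [← Nat.div_add_mod (i : ℕ) n, ← Nat.div_add_mod (j : ℕ) n, h₁, h₂]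
  simp only [kron_apply, Matrix.one_apply, key, ite_and, ite_mul, one_mul, zero_mul]

theorem kronPow_one {n : ℕ} (l : ℕ) : kronPow (1 : Matrix (Fin n) (Fin n) ℂ) l = 1 := by
  induction l with
  | zero => rfl
  | succ l ih => rw [kronPow, ih, kron_one_one]; rfl

theorem τ_one_apply (i j : Fin 2) : τ 1 i j = if (i : ℕ) = 0 ∧ (j : ℕ) = 1 then 1 else 0 := by
  fin_cases i <;> fin_cases j <;> simp [τ]

theorem τ_two_apply (i j : Fin 2) : τ 2 i j = if (i : ℕ) = 1 ∧ (j : ℕ) = 0 then 1 else 0 := by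
  fin_cases i <;> fin_cases j <;> simp [τ]

/-- `τ1^{⊗k}` has its only nonzero entry in the top right corner. -/
theorem kronPow_τ_one_apply (k : ℕ) (i j : Fin (2 ^ k)) :
    kronPow (τ 1) k i j = if (i : ℕ) = 0 ∧ (j : ℕ) + 1 = 2 ^ k then 1 else 0 := by
  induction k with
  | zero =>
    have hi : (i : ℕ) = 0 := by simp
    have hj : (j : ℕ) = 0 := by simp
    have hij : i = j := Fin.ext (hi.trans hj.symm)
    rw [if_pos ⟨hi, by simp⟩, hij]
    exact Matrix.one_apply_eq _
  | succ k ih =>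
    have hstep : ∀ i j : Fin (2 ^ k * 2), kron (kronPow (τ 1) k) (τ 1) i j =
        if (i : ℕ) = 0 ∧ (j : ℕ) + 1 = 2 ^ k * 2 then 1 else 0 := by
      intro i j
      rw [kron_apply, ih, τ_one_apply, ite_zero_mul_ite_zero, one_mul]
      congr 1
      simp only [Fin.coe_divNat, Fin.coe_modNat, eq_iff_iff]
      omega
    exact hstep i j

/-- `τ2 ⊗ τ1^{⊗k}` has its only nonzero entry at `(2^k, 2^k - 1)`. -/
theorem kron_τ_two_kronPow_apply (k : ℕ) (i j : Fin (2 * 2 ^ k)) :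
    kron (τ 2) (kronPow (τ 1) k) i j = if (i : ℕ) = 2 ^ k ∧ (j : ℕ) + 1 = 2 ^ k then 1 else 0 := by
  rw [kron_apply, τ_two_apply, kronPow_τ_one_apply, ite_zero_mul_ite_zero, one_mul]
  congr 1
  have hi := i.isLt
  have hj := j.isLt
  have hp : 0 < 2 ^ k := by positivity
  simp only [Fin.coe_divNat, Fin.coe_modNat, eq_iff_iff]
  constructor
  · rintro ⟨⟨h₁, h₂⟩, h₃, h₄⟩
    have e₁ := Nat.div_add_mod (i : ℕ) (2 ^ k)
    have e₂ := Nat.div_add_mod (j : ℕ) (2 ^ k)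
    rw [h₁, h₃] at e₁
    rw [h₂] at e₂
    omega
  · rintro ⟨h₁, h₂⟩
    have hj' : (j : ℕ) < 2 ^ k := by omega
    rw [h₁, Nat.div_self hp, Nat.mod_self, Nat.div_eq_of_lt hj', Nat.mod_eq_of_lt hj']
    exact ⟨⟨rfl, rfl⟩, rfl, h₂⟩

/-- If `B` is a matrix unit at `(s, s - 1)`, then `I ⊗ B` is supported on the subdiagonal. -/
theorem kron_one_subdiag_apply {n p s : ℕ} (hs : 0 < s) {B : Matrix (Fin p) (Fin p) ℂ}
    (hB : ∀ i j, B i j = if (i : ℕ) = s ∧ (j : ℕ) + 1 = s then 1 else 0) (i j : Fin (n * p)) :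
    kron (1 : Matrix (Fin n) (Fin n) ℂ) B i j =
      if (i : ℕ) = j + 1 ∧ (i : ℕ) % p = s then 1 else 0 := by
  rw [kron_apply, Matrix.one_apply, hB, ite_zero_mul_ite_zero, one_mul]
  congr 1
  simp only [Fin.ext_iff, Fin.coe_divNat, Fin.coe_modNat, eq_iff_iff]
  have e₁ := Nat.div_add_mod (i : ℕ) p
  have e₂ := Nat.div_add_mod (j : ℕ) p
  constructor
  · rintro ⟨h₁, h₂, h₃⟩
    rw [h₁] at e₁
    omega
  · rintro ⟨h₁, h₂⟩
    have hp : 0 < p := Nat.pos_of_ne_zero (by rintro rfl; simpa using i.isLt)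
    have hlt := Nat.mod_lt (i : ℕ) hp
    have hj : (j : ℕ) = (s - 1) + p * ((i : ℕ) / p) := by omega
    have hs' : s - 1 < p := by omega
    refine ⟨?_, h₂, ?_⟩
    · rw [hj, Nat.add_mul_div_left _ _ hp, Nat.div_eq_of_lt hs', zero_add]
    · rw [hj, Nat.add_mul_mod_self_left, Nat.mod_eq_of_lt hs']
      omega

/-- Every `x` not divisible by `2^m` satisfies `x ≡ 2^k [MOD 2^(k+1)]` for exactly one `k < m`. -/
theorem sum_range_ite_mod_two_pow (m x : ℕ) :
    ∑ k ∈ range m, (if x % 2 ^ (k + 1) = 2 ^ k then (1 : ℂ) else 0) =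
      if x % 2 ^ m = 0 then 0 else 1 := by
  induction m with
  | zero => simp [Nat.mod_one]
  | succ m ih =>
    have hp : 0 < 2 ^ m := by positivity
    have hlt := Nat.mod_lt x hp
    rw [sum_range_succ, ih, Nat.mod_pow_succ]
    rcases Nat.mod_two_eq_zero_or_one (x / 2 ^ m) with h | h <;> rw [h]
    · split_ifs <;> first | omega | simp
    · split_ifs <;> first | omega | simp

/-- L₁ = [ I₂^{⊗m} − I₂^{⊗(m−1)} ⊗ τ2 − Σ_{j=2}^{m} I₂^{⊗(j−2)} ⊗ τ2 ⊗ τ1^{⊗(m−j+1)} ] ⊗ I_N. -/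
theorem statement9 (m N : ℕ) (hm : 1 ≤ m) (hN : 1 ≤ N) :
    L1mat m N =
      kron
        (kronPow (1 : Matrix (Fin 2) (Fin 2) ℂ) m -
          mcast (by rw [← pow_succ]; congr 1; omega) (by rw [← pow_succ]; congr 1; omega)
            (kron (kronPow (1 : Matrix (Fin 2) (Fin 2) ℂ) (m - 1)) (τ 2)) -
          ∑ j ∈ (Finset.Icc 2 m).attach,
            mcast
              (by obtain ⟨h2, hj⟩ := Finset.mem_Icc.mp j.2
                  rw [show (2 : ℕ) * 2 ^ (m - ↑j + 1) = 2 ^ (m - ↑j + 2) from (pow_succ' 2 _).symm,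
                    ← pow_add]
                  congr 1; omega)
              (by obtain ⟨h2, hj⟩ := Finset.mem_Icc.mp j.2
                  rw [show (2 : ℕ) * 2 ^ (m - ↑j + 1) = 2 ^ (m - ↑j + 2) from (pow_succ' 2 _).symm,
                    ← pow_add]
                  congr 1; omega)
              (kron (kronPow (1 : Matrix (Fin 2) (Fin 2) ℂ) (↑j - 2))
                (kron (τ 2) (kronPow (τ 1) (m - ↑j + 1)))))
        (1 : Matrix (Fin N) (Fin N) ℂ) := by
  have hfirst : ∀ a b : Fin (2 ^ m), ∀ h,
      mcast h h (kron (1 : Matrix (Fin (2 ^ (m - 1))) (Fin (2 ^ (m - 1))) ℂ) (τ 2)) a b =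
        if (a : ℕ) = b + 1 ∧ (a : ℕ) % 2 ^ (0 + 1) = 2 ^ 0 then 1 else 0 := by
    intro a b h
    rw [mcast_apply, kron_one_subdiag_apply one_pos
      (fun i j => by rw [τ_two_apply]; congr 1; simp)]
    simp
  have hterm : ∀ (k : ℕ) (l : ℕ) (a b : Fin (2 ^ m)), ∀ h,
      mcast h h (kron (1 : Matrix (Fin (2 ^ l)) (Fin (2 ^ l)) ℂ)
        (kron (τ 2) (kronPow (τ 1) k))) a b =
        if (a : ℕ) = b + 1 ∧ (a : ℕ) % 2 ^ (k + 1) = 2 ^ k then 1 else 0 := by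
    intro k l a b h
    rw [mcast_apply, kron_one_subdiag_apply (by positivity) (kron_τ_two_kronPow_apply k)]
    simp [pow_succ']
  have hreindex : ∀ f : ℕ → ℂ, ∑ j ∈ Icc 2 m, f (m - j + 1) = ∑ k ∈ range (m - 1), f (k + 1) := by
    intro f
    refine sum_nbij' (fun j => m - j) (fun k => m - k) ?_ ?_ ?_ ?_ ?_ <;>
      simp only [mem_Icc, mem_range] <;> intros <;> first | omega | trivial
  ext i j
  simp only [kronPow_one]
  rw [kron_apply, Matrix.sub_apply, Matrix.sub_apply, hfirst, Matrix.sum_apply]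
  simp only [hterm]
  set a := i.divNat with ha
  set b := j.divNat with hb
  rw [sum_attach (Icc 2 m) (fun j => if (a : ℕ) = b + 1 ∧
      (a : ℕ) % 2 ^ (m - j + 1 + 1) = 2 ^ (m - j + 1) then (1 : ℂ) else 0),
    hreindex (fun k => if (a : ℕ) = b + 1 ∧ (a : ℕ) % 2 ^ (k + 1) = 2 ^ k then (1 : ℂ) else 0),
    sub_sub, add_comm,
    ← sum_range_succ' (fun k => if (a : ℕ) = b + 1 ∧ (a : ℕ) % 2 ^ (k + 1) = 2 ^ k
      then (1 : ℂ) else 0), Nat.sub_add_cancel hm]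
  have hsum : ∑ k ∈ range m, (if (a : ℕ) = b + 1 ∧ (a : ℕ) % 2 ^ (k + 1) = 2 ^ k
      then (1 : ℂ) else 0) = if (a : ℕ) = b + 1 then 1 else 0 := by
    by_cases h : (a : ℕ) = b + 1
    · simp only [h, true_and, if_true]
      rw [sum_range_ite_mod_two_pow, ← h, Nat.mod_eq_of_lt a.isLt, if_neg (by omega)]
    · simp [h]
  rw [hsum]
  simp only [L1mat, Matrix.of_apply, Matrix.one_apply, Fin.ext_iff, ha, hb, Fin.coe_divNat,
    Fin.coe_modNat]
  split_ifs <;> first | omega | simp
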